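/- Let G be a connected vertex-transitive non-bipartite triangle-free simple graph of degree 6 and even order that is not 4-factor-critical, and suppose λ₅(G) = 16. Then every λ₅-atom S of G satisfies |S| ≥ 9. -/

import Mathlib

open SimpleGraph

section Defs

variable {V : Type*}

/-- A simple graph is vertex-transitive if any vertex can be mapped to any other
by a graph automorphism. -/
def VertexTransitive (G : SimpleGraph V) : Prop :=
  ∀ x y : V, ∃ φ : G ≃g G, φ x = y

/-- A graph is `p`-factor-critical if the removal of any set of `p` vertices
results in a graph with a perfect matching. -/
def PFactorCritical (G : SimpleGraph V) (p : ℕ) : Prop :=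
  ∀ X : Set V, X.ncard = p → ∃ M : (G.induce Xᶜ).Subgraph, M.IsPerfectMatching

/-- A graph is factor-critical if the removal of any single vertex results in a
graph with a perfect matching. -/
def IsFactorCritical {W : Type*} (H : SimpleGraph W) : Prop :=
  ∀ v : W, ∃ M : (H.induce ({v}ᶜ : Set W)).Subgraph, M.IsPerfectMatching

/-- `∇(X)`: the set of edges of `G` with exactly one end in `X`. -/
def edgeBoundary (G : SimpleGraph V) (X : Set V) : Set (Sym2 V) :=
  {e | e ∈ G.edgeSet ∧ ∃ x ∈ X, ∃ y ∈ Xᶜ, e = s(x, y)}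

/-- The set of edges of `G` with both ends in `X`. -/
def edgesWithin (G : SimpleGraph V) (X : Set V) : Set (Sym2 V) :=
  {e | e ∈ G.edgeSet ∧ ∀ v ∈ e, v ∈ X}

/-- The set of edges of `G` with one end in `A` and the other end in `S \ A`
(i.e. the edge boundary of `A` inside the induced subgraph `G[S]` when `A ⊆ S`). -/
def inducedEdgeBoundary (G : SimpleGraph V) (S A : Set V) : Set (Sym2 V) :=
  {e | e ∈ G.edgeSet ∧ ∃ x ∈ A, ∃ y ∈ S \ A, e = s(x, y)}

/-- `F` is an `s`-restricted edge-cut of `G` if deleting `F` disconnects `G` and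
every component of `G − F` has at least `s` vertices. -/
def IsRestrictedEdgeCut (G : SimpleGraph V) (s : ℕ) (F : Set (Sym2 V)) : Prop :=
  F ⊆ G.edgeSet ∧ ¬ (G.deleteEdges F).Connected ∧
    ∀ c : (G.deleteEdges F).ConnectedComponent, s ≤ c.supp.ncard

/-- `λ_s(G)`: the minimum cardinality of an `s`-restricted edge-cut of `G`. -/
noncomputable def lambdaS (G : SimpleGraph V) (s : ℕ) : ℕ :=
  sInf (Set.ncard '' {F | IsRestrictedEdgeCut G s F})

/-- A `λ_s`-fragment: a vertex set whose edge boundary is an `s`-restricted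
edge-cut of minimum cardinality `λ_s(G)`. -/
def IsLambdaFragment (G : SimpleGraph V) (s : ℕ) (X : Set V) : Prop :=
  IsRestrictedEdgeCut G s (edgeBoundary G X) ∧ (edgeBoundary G X).ncard = lambdaS G s

/-- A `λ_s`-atom: a `λ_s`-fragment of minimum cardinality. -/
def IsLambdaAtom (G : SimpleGraph V) (s : ℕ) (X : Set V) : Prop :=
  IsLambdaFragment G s X ∧ ∀ Y : Set V, IsLambdaFragment G s Y → X.ncard ≤ Y.ncard

/-- The odd girth of `G`: the length of a shortest odd cycle of `G`. -/
noncomputable def oddGirth (G : SimpleGraph V) : ℕ :=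
  sInf {n | Odd n ∧ ∃ (v : V) (c : G.Walk v v), c.IsCycle ∧ c.length = n}

/-- `X` is an independent set of `G`. -/
def IsIndependentSet (G : SimpleGraph V) (X : Set V) : Prop :=
  ∀ x ∈ X, ∀ y ∈ X, ¬ G.Adj x y

/-- The independence number `α(G)`. -/
noncomputable def indepNum (G : SimpleGraph V) : ℕ :=
  sSup {n | ∃ X : Set V, IsIndependentSet G X ∧ X.ncard = n}

/-- The number of trivial (single-vertex) components of `G − X`. -/
noncomputable def trivialComponentCount (G : SimpleGraph V) (X : Set V) : ℕ :=
  {c : (G.induce Xᶜ).ConnectedComponent | c.supp.ncard = 1}.ncard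

/-- The number of odd components of `G − X`. -/
noncomputable def oddComponentCount (G : SimpleGraph V) (X : Set V) : ℕ :=
  {c : (G.induce Xᶜ).ConnectedComponent | Odd c.supp.ncard}.ncard

/-- The number of nontrivial components of `G − X`. -/
noncomputable def nontrivialComponentCount (G : SimpleGraph V) (X : Set V) : ℕ :=
  {c : (G.induce Xᶜ).ConnectedComponent | 2 ≤ c.supp.ncard}.ncard

/-- An imprimitive block of `G`: a proper non-empty vertex set that every
automorphism either fixes setwise or maps to a disjoint set. -/
def IsImprimitiveBlock (G : SimpleGraph V) (X : Set V) : Prop :=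
  X.Nonempty ∧ X ≠ Set.univ ∧ ∀ φ : G ≃g G, (⇑φ) '' X = X ∨ ((⇑φ) '' X) ∩ X = ∅

/-- A connected graph is `q`-extendable if it has a perfect matching and every
matching of size `q` is contained in a perfect matching. -/
def Extendable (G : SimpleGraph V) (q : ℕ) : Prop :=
  (∃ M : G.Subgraph, M.IsPerfectMatching) ∧
    ∀ M : G.Subgraph, M.IsMatching → M.edgeSet.ncard = q →
      ∃ P : G.Subgraph, P.IsPerfectMatching ∧ M ≤ P

end Defs


section Helpers

set_option linter.unusedSectionVars false
set_option linter.unusedSimpArgs false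

variable {V : Type*} [Fintype V] [DecidableEq V] (G : SimpleGraph V) [DecidableRel G.Adj]

/-- number of ordered adjacent pairs in `A × B` -/
def ecnt (A B : Finset V) : ℕ := ∑ a ∈ A, ∑ b ∈ B, if G.Adj a b then 1 else 0

theorem ecnt_comm (A B : Finset V) : ecnt G A B = ecnt G B A := by
  unfold ecnt
  rw [Finset.sum_comm]
  simp only [G.adj_comm]

theorem ecnt_union_left {A B : Finset V} (D : Finset V) (h : Disjoint A B) :
    ecnt G (A ∪ B) D = ecnt G A D + ecnt G B D := by
  unfold ecnt
  exact Finset.sum_union h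

theorem ecnt_union_right {A B : Finset V} (D : Finset V) (h : Disjoint A B) :
    ecnt G D (A ∪ B) = ecnt G D A + ecnt G D B := by
  rw [ecnt_comm, ecnt_union_left G D h, ecnt_comm G A, ecnt_comm G B]

theorem ecnt_mono {A B A' B' : Finset V} (h : A ⊆ A') (h' : B ⊆ B') :
    ecnt G A B ≤ ecnt G A' B' := by
  unfold ecnt
  refine (Finset.sum_le_sum_of_subset h).trans (Finset.sum_le_sum fun a _ => ?_)
  exact Finset.sum_le_sum_of_subset h'

theorem ecnt_complete {A B : Finset V} (h : ∀ a ∈ A, ∀ b ∈ B, G.Adj a b) :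
    ecnt G A B = A.card * B.card := by
  unfold ecnt
  rw [Finset.sum_congr rfl (fun a ha => Finset.sum_congr rfl (fun b hb => if_pos (h a ha b hb)))]
  simp

theorem ecnt_eq_zero {A B : Finset V} (h : ∀ a ∈ A, ∀ b ∈ B, ¬ G.Adj a b) :
    ecnt G A B = 0 := by
  unfold ecnt
  rw [Finset.sum_congr rfl (fun a ha => Finset.sum_congr rfl (fun b hb => if_neg (h a ha b hb)))]
  simp

theorem ecnt_pos {A B : Finset V} {a b : V} (ha : a ∈ A) (hb : b ∈ B) (h : G.Adj a b) :
    1 ≤ ecnt G A B := by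
  have h1 : ecnt G {a} {b} = 1 := by
        unfold ecnt; rw [Finset.sum_singleton, Finset.sum_singleton, if_pos h]
  rw [← h1]
  exact ecnt_mono G (by simpa using ha) (by simpa using hb)

theorem ecnt_univ (hreg : G.IsRegularOfDegree 6) (A : Finset V) :
    ecnt G A Finset.univ = 6 * A.card := by
  unfold ecnt
  have : ∀ a ∈ A, (∑ b : V, if G.Adj a b then 1 else 0) = 6 := by
    intro a _
    rw [← hreg a, ← Finset.card_filter, ← G.card_neighborFinset_eq_degree]
    congr 1
    ext b
    simp
  rw [Finset.sum_congr rfl this]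
  simp [mul_comm]

theorem ecnt_compl (hreg : G.IsRegularOfDegree 6) (A B : Finset V) :
    ecnt G A B + ecnt G A Bᶜ = 6 * A.card := by
  rw [← ecnt_univ G hreg A, ← ecnt_union_right G A disjoint_compl_right, Finset.union_compl]

theorem ecnt_map (φ : G ≃g G) (A B : Finset V) :
    ecnt G (A.map φ.toEquiv.toEmbedding) (B.map φ.toEquiv.toEmbedding) = ecnt G A B := by
  unfold ecnt
  simp only [Finset.sum_map]
  refine Finset.sum_congr rfl fun a _ => Finset.sum_congr rfl fun b _ => ?_
  have : G.Adj (φ a) (φ b) ↔ G.Adj a b := φ.map_rel_iff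
  simp [this]

theorem ecnt_self_singleton (v : V) : ecnt G {v} {v} = 0 := by
  simp [ecnt]

theorem ecnt_erase {A : Finset V} {v : V} (h : v ∈ A) (D : Finset V) :
    ecnt G A D = ecnt G {v} D + ecnt G (A.erase v) D := by
  conv_lhs => rw [← Finset.insert_erase h, Finset.insert_eq]
  rw [ecnt_union_left]
  simp

theorem ecnt_erase_right {A : Finset V} {v : V} (h : v ∈ A) (D : Finset V) :
    ecnt G D A = ecnt G D {v} + ecnt G D (A.erase v) := by
  rw [ecnt_comm, ecnt_erase G h, ecnt_comm G D, ecnt_comm G D]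

theorem ecnt_erase_self {A : Finset V} {v : V} (h : v ∈ A) :
    ecnt G A A = 2 * ecnt G {v} A + ecnt G (A.erase v) (A.erase v) := by
  have h1 := ecnt_erase G h A
  have h2 := ecnt_erase_right G h (A.erase v)
  have h3 := ecnt_erase_right G h {v}
  have h4 := ecnt_comm G (A.erase v) {v}
  have h5 := ecnt_self_singleton G v
  omega

theorem ecnt_singleton_le (v : V) (D : Finset V) : ecnt G {v} D ≤ D.card := by
  unfold ecnt
  rw [Finset.sum_singleton, ← Finset.card_filter]
  exact Finset.card_filter_le _ _

theorem tri_free (htri : G.CliqueFree 3) {a b c : V} (h1 : G.Adj a b) (h2 : G.Adj a c)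
    (h3 : G.Adj b c) : False := by
  exact htri {a, b, c} (SimpleGraph.is3Clique_triple_iff.2 ⟨h1, h2, h3⟩)

theorem mantel_aux (htri : G.CliqueFree 3) (n : ℕ) :
    ∀ A : Finset V, A.card = n → 2 * ecnt G A A ≤ n ^ 2 := by
  induction n using Nat.strong_induction_on with
  | _ n ih =>
    intro A hA
    by_cases h : ∃ u ∈ A, ∃ v ∈ A, G.Adj u v
    · obtain ⟨u, hu, v, hv, huv⟩ := h
      have hne : u ≠ v := huv.ne
      have hv' : v ∈ A.erase u := Finset.mem_erase.2 ⟨hne.symm, hv⟩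
      have c1 := Finset.card_erase_add_one hu
      have c2 := Finset.card_erase_add_one hv'
      have e1 := ecnt_erase_self G hu
      have e2 := ecnt_erase_self G hv'
      have e3 := ecnt_erase_right G hu {u}
      have e4 := ecnt_self_singleton G u
      have e5 := ecnt_erase_right G hv' {u}
      have e6 := ecnt_erase_right G hv' {v}
      have e7 := ecnt_self_singleton G v
      have e8 : ecnt G {u} {v} = 1 := by
        unfold ecnt; rw [Finset.sum_singleton, Finset.sum_singleton, if_pos huv]
      set B := (A.erase u).erase v with hB
      have e9 : ecnt G {u} B + ecnt G {v} B ≤ B.card := by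
        unfold ecnt
        rw [Finset.sum_singleton, Finset.sum_singleton, ← Finset.sum_add_distrib,
          Finset.card_eq_sum_ones]
        refine Finset.sum_le_sum fun b _ => ?_
        by_cases h1 : G.Adj u b
        · by_cases h2 : G.Adj v b
          · exact (tri_free G htri huv h1 h2).elim
          · simp [h1, h2]
        · split_ifs <;> omega
      have := ih B.card (by omega) B rfl
      have hn : n = B.card + 2 := by omega
      subst hn
      nlinarith
    · push Not at h
      rw [ecnt_eq_zero G h]
      positivity

theorem mantel (htri : G.CliqueFree 3) (A : Finset V) : 2 * ecnt G A A ≤ A.card ^ 2 :=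
  mantel_aux G htri _ A rfl

theorem boundary_ncard (A : Finset V) :
    (edgeBoundary G (A : Set V)).ncard = ecnt G A Aᶜ := by
  have h1 : ecnt G A Aᶜ = ((A ×ˢ Aᶜ).filter (fun p => G.Adj p.1 p.2)).card := by
    unfold ecnt
    rw [Finset.card_filter, Finset.sum_product]
  have h2 : edgeBoundary G (A : Set V) = (fun p : V × V => s(p.1, p.2)) ''
      (((A ×ˢ Aᶜ).filter (fun p => G.Adj p.1 p.2) : Finset (V × V)) : Set (V × V)) := by
    ext e
    simp only [edgeBoundary, Set.mem_ofPred_eq, Set.mem_image, Finset.coe_filter,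
      Finset.mem_product, Finset.mem_compl, Prod.exists, Set.mem_compl_iff, Finset.mem_coe]
    constructor
    · rintro ⟨he, x, hx, y, hy, rfl⟩
      exact ⟨x, y, ⟨⟨hx, hy⟩, he⟩, rfl⟩
    · rintro ⟨x, y, ⟨⟨hx, hy⟩, he⟩, rfl⟩
      exact ⟨he, x, hx, y, hy, rfl⟩
  rw [h1, h2, Set.InjOn.ncard_image, Set.ncard_coe_finset]
  rintro ⟨a, b⟩ h ⟨a', b'⟩ h' he
  simp only [Finset.coe_filter, Finset.mem_product, Finset.mem_compl, Set.mem_ofPred_eq] at h h'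
  simp only [Sym2.eq_iff] at he
  rcases he with ⟨rfl, rfl⟩ | ⟨rfl, rfl⟩
  · rfl
  · exact absurd h.1.1 h'.1.2

theorem reach_mem (Z : Set V) {a b : V} (h : (G.deleteEdges (edgeBoundary G Z)).Reachable a b) :
    a ∈ Z ↔ b ∈ Z := by
  obtain ⟨p⟩ := h
  induction p with
  | nil => rfl
  | cons hadj p ih =>
    rw [← ih]
    rw [SimpleGraph.deleteEdges_adj] at hadj
    obtain ⟨h1, h2⟩ := hadj
    rename_i u v w
    by_contra hc
    apply h2
    by_cases hu : u ∈ Z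
    · have : v ∉ Z := by tauto
      exact ⟨h1, u, hu, v, this, rfl⟩
    · have : v ∈ Z := by tauto
      exact ⟨h1, v, this, u, hu, Sym2.eq_swap⟩

/-- In a set `Z` with minimal boundary, an isolated part has at least five vertices. -/
theorem part_big (hreg : G.IsRegularOfDegree 6) (htri : G.CliqueFree 3) (Z K : Finset V)
    (hZ : 4 ≤ Z.card) (hZc : 4 ≤ Zᶜ.card) (hd : ecnt G Z Zᶜ < 16)
    (hmin : ∀ Y : Finset V, 4 ≤ Y.card → 4 ≤ Yᶜ.card → ecnt G Z Zᶜ ≤ ecnt G Y Yᶜ)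
    (hKZ : K ⊆ Z) (hK : K.Nonempty) (h0 : ∀ a ∈ K, ∀ b ∈ Z \ K, ¬ G.Adj a b) : 5 ≤ K.card := by
  by_contra hlt
  have hpos : 1 ≤ K.card := hK.card_pos
  have hE := ecnt_eq_zero G h0
  have hE' := ecnt_comm G K (Z \ K)
  have hu : Z = K ∪ (Z \ K) := (Finset.union_sdiff_of_subset hKZ).symm
  have hdis : Disjoint K (Z \ K) := Finset.disjoint_sdiff
  have a1 := ecnt_compl G hreg K K
  have a2 := ecnt_compl G hreg (Z \ K) (Z \ K)
  have a3 := ecnt_compl G hreg Z Z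
  have a4 : ecnt G Z Z = ecnt G K K + ecnt G (Z \ K) (Z \ K) := by
    conv_lhs => rw [hu]
    rw [ecnt_union_left G _ hdis, ecnt_union_right G _ hdis, ecnt_union_right G _ hdis]
    omega
  have a5 : Z.card = K.card + (Z \ K).card := by
    conv_lhs => rw [hu]
    exact Finset.card_union_of_disjoint hdis
  have m1 := mantel G htri K
  have m2 := mantel G htri (Z \ K)
  by_cases hb : 4 ≤ (Z \ K).card
  · have := hmin (Z \ K) hb (hZc.trans (Finset.card_le_card (by
      intro x; simp; tauto)))
    have hk : K.card ≤ 4 := by omega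
    interval_cases K.card <;> omega
  · have h1 : (Z \ K).card ≤ 3 := by omega
    have hk : K.card ≤ 4 := by omega
    interval_cases K.card <;> interval_cases (Z \ K).card <;> omega

theorem cut_ge (hreg : G.IsRegularOfDegree 6) (htri : G.CliqueFree 3)
    (h5 : lambdaS G 5 = 16) (Z : Finset V) (hZ : 4 ≤ Z.card) (hZc : 4 ≤ Zᶜ.card) :
    16 ≤ ecnt G Z Zᶜ := by
  classical
  set F := Finset.univ.filter (fun Y : Finset V => 4 ≤ Y.card ∧ 4 ≤ Yᶜ.card) with hF
  obtain ⟨Y, hY, hmin⟩ := Finset.exists_min_image F (fun Y => ecnt G Y Yᶜ) ⟨Z, by simp [hF, hZ, hZc]⟩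
  have hYZ := hmin Z (by simp [hF, hZ, hZc])
  simp only [hF, Finset.mem_filter, Finset.mem_univ, true_and] at hY hmin
  refine le_trans ?_ hYZ
  by_contra hlt
  push Not at hlt
  have hmin1 : ∀ X : Finset V, 4 ≤ X.card → 4 ≤ Xᶜ.card → ecnt G Y Yᶜ ≤ ecnt G X Xᶜ :=
    fun X h1 h2 => hmin X ⟨h1, h2⟩
  have hcut : IsRestrictedEdgeCut G 5 (edgeBoundary G (Y : Set V)) := by
    refine ⟨fun e he => he.1, ?_, ?_⟩
    · intro hc
      obtain ⟨a, ha⟩ := Finset.card_pos.1 (show 0 < Y.card by omega)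
      obtain ⟨b, hb⟩ := Finset.card_pos.1 (show 0 < Yᶜ.card by omega)
      have := (reach_mem G (Y : Set V) (hc.preconnected a b)).1 (by simpa using ha)
      simp at hb
      exact hb (by simpa using this)
    · intro c
      induction c using SimpleGraph.ConnectedComponent.ind with
      | _ x =>
      set K : Finset V := Finset.univ.filter
        (fun v => (G.deleteEdges (edgeBoundary G (Y : Set V))).Reachable v x) with hKd
      have hsupp : ((G.deleteEdges (edgeBoundary G (Y : Set V))).connectedComponentMk x).supp
          = (K : Set V) := by
        ext v
        simp [hKd, SimpleGraph.ConnectedComponent.mem_supp_iff]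
      rw [hsupp, Set.ncard_coe_finset]
      have hx : x ∈ K := by simp [hKd]
      have key : ∀ a ∈ K, ∀ b ∉ K, (a ∈ Y ↔ b ∈ Y) → ¬ G.Adj a b := by
        intro a ha b hb hab hadj
        apply hb
        simp only [hKd, Finset.mem_filter, Finset.mem_univ, true_and] at ha ⊢
        refine SimpleGraph.Reachable.trans (SimpleGraph.Adj.reachable ?_) ha
        rw [SimpleGraph.deleteEdges_adj]
        refine ⟨hadj.symm, ?_⟩
        rintro ⟨_, p, hp, q, hq, he⟩
        rw [Sym2.eq_iff] at he
        simp only [Set.mem_compl_iff, Finset.mem_coe] at hp hq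
        rcases he with ⟨rfl, rfl⟩ | ⟨rfl, rfl⟩ <;> tauto
      have hKY : ∀ a ∈ K, (a ∈ Y ↔ x ∈ Y) := by
        intro a ha
        simp only [hKd, Finset.mem_filter, Finset.mem_univ, true_and] at ha
        simpa using reach_mem G (Y : Set V) ha
      by_cases hxY : x ∈ Y
      · refine part_big G hreg htri Y K hY.1 hY.2 hlt hmin1 ?_ ⟨x, hx⟩ ?_
        · intro a ha
          exact (hKY a ha).2 hxY
        · intro a ha b hb
          rw [Finset.mem_sdiff] at hb
          exact key a ha b hb.2 (by have := hKY a ha; tauto)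
      · have hcomm : ecnt G Yᶜ Yᶜᶜ = ecnt G Y Yᶜ := by rw [compl_compl, ecnt_comm]
        refine part_big G hreg htri Yᶜ K hY.2 (by simpa using hY.1) (by omega) ?_ ?_ ⟨x, hx⟩ ?_
        · intro X h1 h2
          rw [hcomm]
          exact hmin1 X h1 h2
        · intro a ha
          have := hKY a ha
          simp; tauto
        · intro a ha b hb
          rw [Finset.mem_sdiff, Finset.mem_compl] at hb
          exact key a ha b hb.2 (by have := hKY a ha; tauto)
  have : lambdaS G 5 ≤ (edgeBoundary G (Y : Set V)).ncard := Nat.sInf_le ⟨_, hcut, rfl⟩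
  rw [boundary_ncard] at this
  omega

/-- a copy of `K_{4,4}` -/
def IsCopy (L R : Finset V) : Prop :=
  L.card = 4 ∧ R.card = 4 ∧ ∀ l ∈ L, ∀ r ∈ R, G.Adj l r

theorem IsCopy.symm {L R : Finset V} (h : IsCopy G L R) : IsCopy G R L :=
  ⟨h.2.1, h.1, fun l hl r hr => (h.2.2 r hr l hl).symm⟩

theorem IsCopy.disj {L R : Finset V} (h : IsCopy G L R) : Disjoint L R := by
  rw [Finset.disjoint_left]
  intro a ha hb
  exact (h.2.2 a ha a hb).ne rfl

theorem IsCopy.map {L R : Finset V} (h : IsCopy G L R) (φ : G ≃g G) :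
    IsCopy G (L.map φ.toEquiv.toEmbedding) (R.map φ.toEquiv.toEmbedding) := by
  refine ⟨by rw [Finset.card_map]; exact h.1, by rw [Finset.card_map]; exact h.2.1, ?_⟩
  intro l hl r hr
  rw [Finset.mem_map] at hl hr
  obtain ⟨l, hl, rfl⟩ := hl
  obtain ⟨r, hr, rfl⟩ := hr
  exact φ.map_rel_iff.2 (h.2.2 l hl r hr)

theorem ecnt_singleton (v : V) (D : Finset V) :
    ecnt G {v} D = (D.filter (fun b => G.Adj v b)).card := by
  unfold ecnt
  rw [Finset.sum_singleton, ← Finset.card_filter]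

theorem ecnt_sum (A D : Finset V) : ecnt G A D = ∑ a ∈ A, ecnt G {a} D := by
  unfold ecnt
  simp only [Finset.sum_singleton]

theorem exists_copy (htri : G.CliqueFree 3) (S : Finset V) (hS : S.card = 8)
    (hE : ecnt G S S = 32) : ∃ L R, IsCopy G L R := by
  have hge : ∀ w ∈ S, 4 ≤ ecnt G {w} S := by
    intro w hw
    have h1 := ecnt_erase_self G hw
    have h2 := mantel G htri (S.erase w)
    have h3 := Finset.card_erase_add_one hw
    have h4 : (S.erase w).card = 7 := by omega
    rw [h4] at h2
    omega
  have heq : ∀ w ∈ S, ecnt G {w} S = 4 := by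
    have hsum : ∑ w ∈ S, 4 = ∑ w ∈ S, ecnt G {w} S := by
      rw [← ecnt_sum, hE]; simp [hS]
    intro w hw
    exact (((Finset.sum_eq_sum_iff_of_le hge).1 hsum) w hw).symm
  have hdeg : ∀ w ∈ S, (S.filter (fun b => G.Adj w b)).card = 4 := by
    intro w hw
    rw [← ecnt_singleton]
    exact heq w hw
  obtain ⟨u, hu⟩ := Finset.card_pos.1 (show 0 < S.card by omega)
  set R := S.filter (fun b => G.Adj u b) with hR
  have hRc : R.card = 4 := hdeg u hu
  obtain ⟨v, hv⟩ := Finset.card_pos.1 (show 0 < R.card by omega)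
  have hv1 : v ∈ S ∧ G.Adj u v := by simpa [hR] using hv
  set L := S.filter (fun b => G.Adj v b) with hL
  have hLc : L.card = 4 := hdeg v hv1.1
  have hdis : Disjoint L R := by
    rw [Finset.disjoint_left]
    intro a ha hb
    have ha' : a ∈ S ∧ G.Adj v a := by simpa [hL] using ha
    have hb' : a ∈ S ∧ G.Adj u a := by simpa [hR] using hb
    exact tri_free G htri hv1.2 hb'.2 ha'.2
  have hun : L ∪ R = S := by
    apply Finset.eq_of_subset_of_card_le
    · intro x hx
      rw [Finset.mem_union] at hx
      rcases hx with hx | hx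
      · exact (Finset.mem_filter.1 hx).1
      · exact (Finset.mem_filter.1 hx).1
    · rw [Finset.card_union_of_disjoint hdis]; omega
  refine ⟨L, R, hLc, hRc, ?_⟩
  intro l hl r hr
  have hl' : l ∈ S ∧ G.Adj v l := by simpa [hL] using hl
  have hsub : S.filter (fun b => G.Adj l b) ⊆ R := by
    intro x hx
    rw [Finset.mem_filter] at hx
    have hx2 := hx.1
    rw [← hun, Finset.mem_union] at hx2
    rcases hx2 with h | h
    · have h' : x ∈ S ∧ G.Adj v x := by simpa [hL] using h
      exact (tri_free G htri hl'.2 h'.2 hx.2).elim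
    · exact h
  have := Finset.eq_of_subset_of_card_le hsub (by rw [hdeg l hl'.1, hRc])
  rw [← this] at hr
  exact (Finset.mem_filter.1 hr).2

theorem copy_cover (hvt : VertexTransitive G) (h : ∃ L R, IsCopy G L R) (v : V) :
    ∃ L R, IsCopy G L R ∧ v ∈ L := by
  obtain ⟨L, R, hLR⟩ := h
  obtain ⟨u, hu⟩ := Finset.card_pos.1 (show 0 < L.card by rw [hLR.1]; omega)
  obtain ⟨φ, hφ⟩ := hvt u v
  refine ⟨_, _, hLR.map G φ, ?_⟩
  rw [Finset.mem_map]
  exact ⟨u, hu, hφ⟩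

/-- number of ordered monochromatic adjacent pairs of the colouring `X`, `Xᶜ` -/
def mono (X : Finset V) : ℕ := ecnt G X X + ecnt G Xᶜ Xᶜ

theorem mono_compl (X : Finset V) : mono G Xᶜ = mono G X := by
  unfold mono
  rw [compl_compl, add_comm]

theorem mono_erase (hreg : G.IsRegularOfDegree 6) {X : Finset V} {u : V} (h : u ∈ X) :
    mono G (X.erase u) + 4 * ecnt G {u} X = mono G X + 12 := by
  unfold mono
  have h1 := ecnt_erase_self G h
  have hu : u ∈ (X.erase u)ᶜ := by simp
  have h2 := ecnt_erase_self G hu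
  have h3 : (X.erase u)ᶜ.erase u = Xᶜ := by
    ext x
    simp only [Finset.mem_erase, Finset.mem_compl]
    by_cases hx : x = u
    · subst hx; simp [h]
    · simp [hx]
  rw [h3] at h2
  have h4 := ecnt_compl G hreg {u} (X.erase u)
  have h5 := ecnt_erase_right G h {u}
  have h6 := ecnt_self_singleton G u
  rw [Finset.card_singleton] at h4
  omega

theorem mono_map (φ : G ≃g G) (X : Finset V) :
    mono G (X.map φ.toEquiv.toEmbedding) = mono G X := by
  unfold mono
  have : (X.map φ.toEquiv.toEmbedding)ᶜ = Xᶜ.map φ.toEquiv.toEmbedding := by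
    ext x
    simp only [Finset.mem_compl, Finset.mem_map_equiv]
  rw [this, ecnt_map, ecnt_map]

/-- in a minimal colouring every vertex has at most 3 neighbours of its colour -/
theorem min_le (hreg : G.IsRegularOfDegree 6) {X : Finset V} (hmin : ∀ Y, mono G X ≤ mono G Y)
    {u : V} (h : u ∈ X) : ecnt G {u} X ≤ 3 := by
  have := mono_erase G hreg h
  have := hmin (X.erase u)
  omega

theorem min_compl {X : Finset V} (hmin : ∀ Y, mono G X ≤ mono G Y) :
    ∀ Y, mono G Xᶜ ≤ mono G Y := by
  intro Y
  rw [mono_compl]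
  exact hmin Y

theorem adj_card_le {u : V} {B D : Finset V} (h : ∀ b ∈ B, G.Adj u b) (hBD : B ⊆ D) :
    B.card ≤ ecnt G {u} D := by
  have h1 := ecnt_complete G (A := {u}) (B := B) (by simpa using h)
  have h2 := ecnt_mono G (Finset.Subset.refl {u}) hBD
  simp at h1
  omega

theorem mono_ge (X L R : Finset V) (h : IsCopy G L R) :
    2 * ((L ∩ X).card * (R ∩ X).card + (L \ X).card * (R \ X).card) ≤ mono G X := by
  have key : ∀ A B D : Finset V, A ⊆ D → B ⊆ D → Disjoint A B → (∀ a ∈ A, ∀ b ∈ B, G.Adj a b) →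
      2 * (A.card * B.card) ≤ ecnt G D D := by
    intro A B D hA hB hd hadj
    have h1 := ecnt_complete G hadj
    have h2 := ecnt_comm G A B
    have h3 := ecnt_mono G (Finset.union_subset hA hB) (Finset.union_subset hA hB)
    rw [ecnt_union_left G _ hd, ecnt_union_right G _ hd, ecnt_union_right G _ hd] at h3
    omega
  have hd := h.disj
  have k1 := key (L ∩ X) (R ∩ X) X Finset.inter_subset_right Finset.inter_subset_right
    (hd.mono Finset.inter_subset_left Finset.inter_subset_left)
    (fun a ha b hb => h.2.2 a (Finset.mem_inter.1 ha).1 b (Finset.mem_inter.1 hb).1)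
  have k2 := key (L \ X) (R \ X) Xᶜ (by intro x; simp) (by intro x; simp)
    (hd.mono Finset.sdiff_subset Finset.sdiff_subset)
    (fun a ha b hb => h.2.2 a (Finset.mem_sdiff.1 ha).1 b (Finset.mem_sdiff.1 hb).1)
  unfold mono
  omega

/-- almost proper, with `L` mostly outside `X` -/
theorem min_proper_aux (hreg : G.IsRegularOfDegree 6) {X : Finset V}
    (hmin : ∀ Y, mono G X ≤ mono G Y) {L R : Finset V} (h : IsCopy G L R)
    (hL : L ⊆ Xᶜ) (_hR : 1 ≤ (R ∩ X).card) : R ⊆ X := by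
  intro r hr
  by_contra hrX
  have h1 := min_le G hreg (min_compl G hmin) (u := r) (by simpa using hrX)
  have h2 := adj_card_le G (u := r) (B := L) (fun b hb => (h.2.2 b hb r hr).symm) hL
  have := h.1
  omega

theorem min_proper_aux2 (hreg : G.IsRegularOfDegree 6) {X : Finset V}
    (hmin : ∀ Y, mono G X ≤ mono G Y) {L R : Finset V} (h : IsCopy G L R)
    (hL : (L ∩ X).card ≤ 1) (hR : 3 ≤ (R ∩ X).card) : L ⊆ Xᶜ ∧ R ⊆ X := by
  by_cases h0 : (L ∩ X).card = 0
  · have hLX : L ⊆ Xᶜ := by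
      rw [Finset.card_eq_zero] at h0
      intro l hl
      rw [Finset.mem_compl]
      intro hlX
      have : l ∈ L ∩ X := Finset.mem_inter.2 ⟨hl, hlX⟩
      rw [h0] at this
      simp at this
    exact ⟨hLX, min_proper_aux G hreg hmin h hLX (by omega)⟩
  · exfalso
    obtain ⟨u, hu⟩ := Finset.card_eq_one.1 (show (L ∩ X).card = 1 by omega)
    have huLX : u ∈ L ∩ X := by rw [hu]; simp
    rw [Finset.mem_inter] at huLX
    have h1 := min_le G hreg hmin huLX.2
    have h2 := adj_card_le G (u := u) (B := R ∩ X)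
      (fun b hb => h.2.2 u huLX.1 b (Finset.mem_inter.1 hb).1) Finset.inter_subset_right
    have h3 := mono_erase G hreg huLX.2
    have hmin' : ∀ Y, mono G (X.erase u) ≤ mono G Y := by
      intro Y
      have := hmin Y
      omega
    have huR : u ∉ R := Finset.disjoint_left.1 h.disj huLX.1
    have hLX : L ⊆ (X.erase u)ᶜ := by
      intro l hl
      simp only [Finset.mem_compl, Finset.mem_erase, not_and]
      intro hne hlX
      have : l ∈ L ∩ X := Finset.mem_inter.2 ⟨hl, hlX⟩
      rw [hu] at this
      simp at this
      exact hne this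
    have hRX : R ∩ X.erase u = R ∩ X := by
      ext x
      simp only [Finset.mem_inter, Finset.mem_erase]
      constructor
      · tauto
      · rintro ⟨a, b⟩
        exact ⟨a, fun hx => huR (hx ▸ a), b⟩
    have h4 := min_proper_aux G hreg hmin' h hLX (by rw [hRX]; omega)
    have h5 := adj_card_le G (u := u) (B := R) (fun b hb => h.2.2 u huLX.1 b hb)
      (h4.trans (Finset.erase_subset _ _))
    have := h.2.1
    omega

theorem min_proper (hreg : G.IsRegularOfDegree 6) {X : Finset V} (hm : mono G X ≤ 14)
    (hmin : ∀ Y, mono G X ≤ mono G Y) {L R : Finset V} (h : IsCopy G L R) :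
    (L ⊆ Xᶜ ∧ R ⊆ X) ∨ (R ⊆ Xᶜ ∧ L ⊆ X) := by
  have h1 := mono_ge G X L R h
  have h2 := Finset.card_inter_add_card_sdiff L X
  have h3 := Finset.card_inter_add_card_sdiff R X
  have hl := h.1
  have hr := h.2.1
  have h4 : ((L ∩ X).card ≤ 1 ∧ 3 ≤ (R ∩ X).card) ∨ ((R ∩ X).card ≤ 1 ∧ 3 ≤ (L ∩ X).card) := by
    have e1 : (L \ X).card = 4 - (L ∩ X).card := by omega
    have e2 : (R \ X).card = 4 - (R ∩ X).card := by omega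
    have b1 : (L ∩ X).card ≤ 4 := by omega
    have b2 : (R ∩ X).card ≤ 4 := by omega
    rw [e1, e2] at h1
    have h1' := h1.trans hm
    clear h1 h2 h3 e1 e2
    generalize (L ∩ X).card = a at *
    generalize (R ∩ X).card = b at *
    interval_cases a <;> interval_cases b <;> simp_all
  rcases h4 with h4 | h4
  · exact Or.inl (min_proper_aux2 G hreg hmin h h4.1 h4.2)
  · exact Or.inr (min_proper_aux2 G hreg hmin h.symm h4.1 h4.2)

theorem diff_cut (X Y : Finset V) :
    2 * ecnt G (symmDiff X Y) (symmDiff X Y)ᶜ ≤ mono G X + mono G Y := by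
  have d1 : symmDiff X Y = (X \ Y) ∪ (Y \ X) := rfl
  have d2 : (symmDiff X Y)ᶜ = (X ∩ Y) ∪ (Xᶜ ∩ Yᶜ) := by
    ext x; simp [Finset.mem_symmDiff]; tauto
  have d3 : X = (X \ Y) ∪ (X ∩ Y) := by ext x; simp; tauto
  have d4 : Y = (Y \ X) ∪ (X ∩ Y) := by ext x; simp; tauto
  have d5 : Xᶜ = (Y \ X) ∪ (Xᶜ ∩ Yᶜ) := by ext x; simp; tauto
  have d6 : Yᶜ = (X \ Y) ∪ (Xᶜ ∩ Yᶜ) := by ext x; simp; tauto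
  have q1 : Disjoint (X \ Y) (Y \ X) := by
    rw [Finset.disjoint_left]; intro x; simp; tauto
  have q2 : Disjoint (X ∩ Y) (Xᶜ ∩ Yᶜ) := by
    rw [Finset.disjoint_left]; intro x; simp; tauto
  have q3 : Disjoint (X \ Y) (X ∩ Y) := by
    rw [Finset.disjoint_left]; intro x; simp; tauto
  have q4 : Disjoint (Y \ X) (X ∩ Y) := by
    rw [Finset.disjoint_left]; intro x; simp; tauto
  have q5 : Disjoint (Y \ X) (Xᶜ ∩ Yᶜ) := by
    rw [Finset.disjoint_left]; intro x; simp; tauto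
  have q6 : Disjoint (X \ Y) (Xᶜ ∩ Yᶜ) := by
    rw [Finset.disjoint_left]; intro x; simp; tauto
  have sp : ∀ A B D : Finset V, D = A ∪ B → Disjoint A B → 2 * ecnt G A B ≤ ecnt G D D := by
    intro A B D hD hd
    subst hD
    rw [ecnt_union_left G _ hd, ecnt_union_right G _ hd, ecnt_union_right G _ hd]
    have := ecnt_comm G A B
    omega
  have s1 := sp _ _ _ d3 q3
  have s2 := sp _ _ _ d4 q4
  have s3 := sp _ _ _ d5 q5
  have s4 := sp _ _ _ d6 q6
  rw [d2, d1, ecnt_union_left G _ q1, ecnt_union_right G _ q2, ecnt_union_right G _ q2]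
  unfold mono
  omega

/-- no 2-colouring with few monochromatic edges -/
theorem no_coloring (hvt : VertexTransitive G) (hnb : ¬ G.Colorable 2)
    (hreg : G.IsRegularOfDegree 6) (htri : G.CliqueFree 3) (h5 : lambdaS G 5 = 16)
    (hcopy : ∃ L R, IsCopy G L R) (hcard : 13 ≤ Fintype.card V)
    (X0 : Finset V) (hX0 : mono G X0 ≤ 12) : False := by
  obtain ⟨X, -, hmin⟩ := Finset.exists_min_image Finset.univ (fun Y : Finset V => mono G Y)
    ⟨X0, Finset.mem_univ _⟩
  replace hmin : ∀ Y, mono G X ≤ mono G Y := fun Y => hmin Y (Finset.mem_univ _)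
  have hX : mono G X ≤ 12 := (hmin X0).trans hX0
  -- invariance
  have hinv : ∀ φ : G ≃g G, X.map φ.toEquiv.toEmbedding = X ∨
      X.map φ.toEquiv.toEmbedding = Xᶜ := by
    intro φ
    set Y := X.map φ.toEquiv.toEmbedding with hY
    have hYm : mono G Y = mono G X := mono_map G φ X
    have hYmin : ∀ W, mono G Y ≤ mono G W := by rw [hYm]; exact hmin
    have hd := diff_cut G X Y
    have hcop : ∀ L R, IsCopy G L R → L ∪ R ⊆ symmDiff X Y ∨ L ∪ R ⊆ (symmDiff X Y)ᶜ := by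
      intro L R h
      have a1 := min_proper G hreg (by omega) hmin h
      have a2 := min_proper G hreg (by omega) hYmin h
      simp only [Finset.subset_iff, Finset.mem_union, Finset.mem_symmDiff, Finset.mem_compl]
        at a1 a2 ⊢
      rcases a1 with ⟨a, b⟩ | ⟨a, b⟩ <;> rcases a2 with ⟨c, d⟩ | ⟨c, d⟩
      · right
        rintro x (hx | hx)
        · have := a hx; have := c hx; tauto
        · have := b hx; have := d hx; tauto
      · left
        rintro x (hx | hx)
        · have := a hx; have := d hx; tauto
        · have := b hx; have := c hx; tauto
      · left
        rintro x (hx | hx)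
        · have := b hx; have := c hx; tauto
        · have := a hx; have := d hx; tauto
      · right
        rintro x (hx | hx)
        · have := b hx; have := d hx; tauto
        · have := a hx; have := c hx; tauto
    have hbig : ∀ W : Finset V, (∀ L R, IsCopy G L R → L ∪ R ⊆ W ∨ L ∪ R ⊆ Wᶜ) → W.Nonempty →
        4 ≤ W.card := by
      rintro W hW ⟨w, hw⟩
      obtain ⟨L, R, hLR, hwL⟩ := copy_cover G hvt hcopy w
      rcases hW L R hLR with h | h
      · have := Finset.card_le_card (Finset.subset_union_left.trans h)
        rw [hLR.1] at this
        exact this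
      · have := h (Finset.mem_union_left _ hwL)
        simp [hw] at this
    rcases Finset.eq_empty_or_nonempty (symmDiff X Y) with he | hne
    · left
      rw [← Finset.bot_eq_empty, symmDiff_eq_bot] at he
      exact he.symm
    · rcases Finset.eq_empty_or_nonempty (symmDiff X Y)ᶜ with he | hne'
      · right
        ext x
        have : x ∉ (symmDiff X Y)ᶜ := by rw [he]; simp
        simp only [Finset.mem_compl, Finset.mem_symmDiff] at this ⊢
        tauto
      · have b1 := hbig _ hcop hne
        have b2 := hbig _ (fun L R h => by rw [compl_compl]; exact (hcop L R h).symm) hne'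
        have := cut_ge G hreg htri h5 _ b1 b2
        omega
  -- a monochromatic edge
  have hmonoedge : ∃ a b, G.Adj a b ∧ (a ∈ X ↔ b ∈ X) := by
    by_contra hno
    push Not at hno
    apply hnb
    have col : G.Coloring Bool := SimpleGraph.Coloring.mk (fun v => decide (v ∈ X)) (by
      intro v w hvw he
      have := hno v w hvw
      simp only [decide_eq_decide] at he
      tauto)
    have := col.colorable
    simpa using this
  obtain ⟨a, b, hab, habX⟩ := hmonoedge
  have hall : ∀ v, ∃ w, G.Adj v w ∧ (v ∈ X ↔ w ∈ X) := by
    intro v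
    obtain ⟨φ, rfl⟩ := hvt a v
    refine ⟨φ b, φ.map_rel_iff.2 hab, ?_⟩
    have key : ∀ c, φ c ∈ X.map φ.toEquiv.toEmbedding ↔ c ∈ X := by
      intro c
      exact Finset.mem_map' φ.toEquiv.toEmbedding
    rcases hinv φ with h | h
    · rw [h] at key
      rw [key, key, habX]
    · rw [h] at key
      have ka := key a
      have kb := key b
      simp only [Finset.mem_compl] at ka kb
      tauto
  have hge : ∀ D : Finset V, (∀ v w, v ∈ D → (v ∈ X ↔ w ∈ X) → w ∈ D) → D.card ≤ ecnt G D D := by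
    intro D hD
    rw [ecnt_sum, Finset.card_eq_sum_ones]
    refine Finset.sum_le_sum fun v hv => ?_
    obtain ⟨w, hvw, hw⟩ := hall v
    exact ecnt_pos G (Finset.mem_singleton_self v) (hD v w hv hw) hvw
  have g1 := hge X (by intro v w; tauto)
  have g2 := hge Xᶜ (by intro v w; simp only [Finset.mem_compl]; tauto)
  have g3 := Finset.card_add_card_compl X
  unfold mono at hX
  omega

theorem copy_count (hvt : VertexTransitive G) (hcopy : ∃ L R, IsCopy G L R) (A B D : Finset V)
    (h : ∀ L R, IsCopy G L R →
      ((L ∪ R) ∩ A).card ≤ ((L ∪ R) ∩ B).card + ((L ∪ R) ∩ D).card) :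
    A.card ≤ B.card + D.card := by
  classical
  set F : Finset (Finset V × Finset V) := Finset.univ.filter (fun p => IsCopy G p.1 p.2) with hF
  set k : V → ℕ := fun v => (F.filter (fun p => v ∈ p.1 ∪ p.2)).card with hk
  have kle : ∀ v w, k v ≤ k w := by
    intro v w
    obtain ⟨φ, rfl⟩ := hvt v w
    refine Finset.card_le_card_of_injOn
      (fun p => (p.1.map φ.toEquiv.toEmbedding, p.2.map φ.toEquiv.toEmbedding)) ?_ ?_
    · intro p hp
      simp only [hF, Finset.coe_filter, Finset.mem_filter, Finset.mem_univ, true_and,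
        Set.mem_ofPred_eq, Finset.mem_union] at hp ⊢
      refine ⟨hp.1.map G φ, ?_⟩
      rcases hp.2 with h | h
      · exact Or.inl (Finset.mem_map_of_mem φ.toEquiv.toEmbedding h)
      · exact Or.inr (Finset.mem_map_of_mem φ.toEquiv.toEmbedding h)
    · intro p _ q _ hpq
      simp only [Prod.mk.injEq, Finset.map_inj] at hpq
      exact Prod.ext hpq.1 hpq.2
  obtain ⟨L, R, hLR⟩ := hcopy
  obtain ⟨v0, hv0⟩ := Finset.card_pos.1 (show 0 < L.card by rw [hLR.1]; omega)
  have kpos : 0 < k v0 := Finset.card_pos.2 ⟨(L, R), by simp [hF, hLR, hv0]⟩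
  have kconst : ∀ v, k v = k v0 := fun v => le_antisymm (kle _ _) (kle _ _)
  have count : ∀ T : Finset V, ∑ p ∈ F, ((p.1 ∪ p.2) ∩ T).card = T.card * k v0 := by
    intro T
    have e1 : ∀ p ∈ F, ((p.1 ∪ p.2) ∩ T).card = ∑ v ∈ T, if v ∈ p.1 ∪ p.2 then 1 else 0 := by
      intro p _
      rw [← Finset.card_filter]
      congr 1
      ext x
      simp [and_comm]
    rw [Finset.sum_congr rfl e1, Finset.sum_comm]
    have e2 : ∀ v ∈ T, (∑ p ∈ F, if v ∈ p.1 ∪ p.2 then 1 else 0) = k v0 := by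
      intro v _
      rw [← kconst v]
      exact (Finset.card_filter _ _).symm
    rw [Finset.sum_congr rfl e2]
    simp
  have hs : ∑ p ∈ F, ((p.1 ∪ p.2) ∩ A).card ≤
      ∑ p ∈ F, (((p.1 ∪ p.2) ∩ B).card + ((p.1 ∪ p.2) ∩ D).card) := by
    refine Finset.sum_le_sum fun p hp => h p.1 p.2 ?_
    simpa [hF] using hp
  rw [Finset.sum_add_distrib, count, count, count, ← add_mul] at hs
  exact Nat.le_of_mul_le_mul_right hs kpos

theorem cut_erase (hreg : G.IsRegularOfDegree 6) {A : Finset V} {v : V} (h : v ∈ A) :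
    ecnt G (A.erase v) (A.erase v)ᶜ + 2 * ecnt G {v} Aᶜ = ecnt G A Aᶜ + 6 := by
  have h1 := ecnt_compl G hreg A A
  have h2 := ecnt_compl G hreg (A.erase v) (A.erase v)
  have h3 := ecnt_compl G hreg {v} A
  have h4 := ecnt_erase_self G h
  have h5 := Finset.card_erase_add_one h
  rw [Finset.card_singleton] at h3
  omega

/-- at most one vertex of `A` can have four neighbours outside `A` when the cut is small -/
theorem bad_le_one (hreg : G.IsRegularOfDegree 6) (htri : G.CliqueFree 3)
    (h5 : lambdaS G 5 = 16) (A : Finset V) (hA : 6 ≤ A.card) (hAc : 4 ≤ Aᶜ.card)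
    (hd : ecnt G A Aᶜ ≤ 18) : (A.filter (fun v => 4 ≤ ecnt G {v} Aᶜ)).card ≤ 1 := by
  rw [Finset.card_le_one]
  intro u hu v hv
  rw [Finset.mem_filter] at hu hv
  by_contra hne
  have hv' : v ∈ A.erase u := Finset.mem_erase.2 ⟨fun h => hne h.symm, hv.1⟩
  have e1 := cut_erase G hreg hu.1
  have e2 := cut_erase G hreg hv'
  have e3 : ecnt G {v} Aᶜ ≤ ecnt G {v} (A.erase u)ᶜ :=
    ecnt_mono G (Finset.Subset.refl _) (Finset.compl_subset_compl.2 (Finset.erase_subset _ _))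
  have c1 := Finset.card_erase_add_one hu.1
  have c2 := Finset.card_erase_add_one hv'
  have c3 : Aᶜ.card ≤ ((A.erase u).erase v)ᶜ.card :=
    Finset.card_le_card (Finset.compl_subset_compl.2
      ((Finset.erase_subset _ _).trans (Finset.erase_subset _ _)))
  have := cut_ge G hreg htri h5 ((A.erase u).erase v) (by omega) (by omega)
  omega

theorem bad_zero (hreg : G.IsRegularOfDegree 6) (htri : G.CliqueFree 3)
    (h5 : lambdaS G 5 = 16) (A : Finset V) (hA : 6 ≤ A.card) (hAc : 4 ≤ Aᶜ.card)
    (hd : ecnt G A Aᶜ ≤ 16) {u v : V} (hu : u ∈ A) (hv : v ∈ A) (huv : G.Adj u v)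
    (hu3 : 3 ≤ ecnt G {u} Aᶜ) (hv3 : 3 ≤ ecnt G {v} Aᶜ) : False := by
  have hv' : v ∈ A.erase u := Finset.mem_erase.2 ⟨huv.ne.symm, hv⟩
  have e1 := cut_erase G hreg hu
  have e2 := cut_erase G hreg hv'
  have hcu : (A.erase u)ᶜ = {u} ∪ Aᶜ := by
    ext x
    simp only [Finset.mem_compl, Finset.mem_erase, Finset.mem_union, Finset.mem_singleton]
    tauto
  have e3 : ecnt G {v} (A.erase u)ᶜ = ecnt G {v} {u} + ecnt G {v} Aᶜ := by
    rw [hcu]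
    exact ecnt_union_right G _ (by simpa using hu)
  have e4 := ecnt_pos G (Finset.mem_singleton_self v) (Finset.mem_singleton_self u) huv.symm
  have c1 := Finset.card_erase_add_one hu
  have c2 := Finset.card_erase_add_one hv'
  have c3 : Aᶜ.card ≤ ((A.erase u).erase v)ᶜ.card :=
    Finset.card_le_card (Finset.compl_subset_compl.2
      ((Finset.erase_subset _ _).trans (Finset.erase_subset _ _)))
  have := cut_ge G hreg htri h5 ((A.erase u).erase v) (by omega) (by omega)
  omega

theorem double_le {A B D : Finset V} (hA : A ⊆ D) (hB : B ⊆ D) (hd : Disjoint A B)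
    (hadj : ∀ a ∈ A, ∀ b ∈ B, G.Adj a b) : 2 * (A.card * B.card) ≤ ecnt G D D := by
  have h1 := ecnt_complete G hadj
  have h2 := ecnt_comm G A B
  have h3 := ecnt_mono G (Finset.union_subset hA hB) (Finset.union_subset hA hB)
  rw [ecnt_union_left G _ hd, ecnt_union_right G _ hd, ecnt_union_right G _ hd] at h3
  omega

theorem union_inter_card {L R : Finset V} (h : Disjoint L R) (A : Finset V) :
    ((L ∪ R) ∩ A).card = (L ∩ A).card + (R ∩ A).card := by
  rw [Finset.union_inter_distrib_right]
  exact Finset.card_union_of_disjoint (h.mono Finset.inter_subset_left Finset.inter_subset_left)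

/-- the case that `L` meets `I` -/
theorem copy_caseI (X C B : Finset V) (hEX : ecnt G X X ≤ 2)
    (hI : ∀ a ∈ (X ∪ C)ᶜ, ∀ b, b ∉ X → ¬ G.Adj a b)
    (hXC : Disjoint X C)
    (hB1 : ∀ v ∈ C, 4 ≤ ecnt G {v} Cᶜ → v ∈ B)
    {L R : Finset V} (h : IsCopy G L R) (hne : (L ∩ (X ∪ C)ᶜ).Nonempty) :
    ((L ∪ R) ∩ X).card ≤ ((L ∪ R) ∩ (X ∪ C)ᶜ).card + ((L ∪ R) ∩ B).card := by
  obtain ⟨i, hi⟩ := hne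
  rw [Finset.mem_inter] at hi
  have hRX : R ⊆ X := by
    intro r hr
    by_contra hrX
    exact hI i hi.2 r hrX (h.2.2 i hi.1 r hr)
  have hdis := h.disj
  have hLX : L ∩ X = ∅ := by
    have := double_le G (A := L ∩ X) (B := R) (D := X) Finset.inter_subset_right hRX
      (hdis.mono_left Finset.inter_subset_left)
      (fun a ha b hb => h.2.2 a (Finset.mem_inter.1 ha).1 b hb)
    rw [h.2.1] at this
    rw [← Finset.card_eq_zero]
    omega
  have hLC : L ⊆ (L ∩ (X ∪ C)ᶜ) ∪ (L ∩ B) := by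
    intro l hl
    by_cases hlC : l ∈ C
    · refine Finset.mem_union_right _ (Finset.mem_inter.2 ⟨hl, hB1 l hlC ?_⟩)
      rw [← h.2.1]
      refine adj_card_le G (fun b hb => h.2.2 l hl b hb) ?_
      intro r hr
      rw [Finset.mem_compl]
      exact Finset.disjoint_left.1 hXC (hRX hr)
    · have hlX : l ∉ X := by
        intro hlX
        have : l ∈ L ∩ X := Finset.mem_inter.2 ⟨hl, hlX⟩
        rw [hLX] at this
        simp at this
      refine Finset.mem_union_left _ (Finset.mem_inter.2 ⟨hl, ?_⟩)
      simp [hlC, hlX]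
  have c1 := (Finset.card_le_card hLC).trans (Finset.card_union_le _ _)
  have c2 : (R ∩ X).card ≤ R.card := Finset.card_le_card Finset.inter_subset_left
  rw [union_inter_card hdis, union_inter_card hdis, union_inter_card hdis, hLX,
    Finset.card_empty]
  have := h.1
  have := h.2.1
  omega

/-- the case that the copy avoids `I` and `R` avoids `X` -/
theorem copy_caseX (X C B : Finset V)
    (hB2 : ∀ v ∈ X, 4 ≤ ecnt G {v} C → v ∈ B)
    {L R : Finset V} (h : IsCopy G L R) (hR : R ⊆ C) (hRX : R ∩ X = ∅) :
    ((L ∪ R) ∩ X).card ≤ ((L ∪ R) ∩ (X ∪ C)ᶜ).card + ((L ∪ R) ∩ B).card := by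
  have hdis := h.disj
  have hLB : L ∩ X ⊆ L ∩ B := by
    intro l hl
    rw [Finset.mem_inter] at hl
    refine Finset.mem_inter.2 ⟨hl.1, hB2 l hl.2 ?_⟩
    rw [← h.2.1]
    exact adj_card_le G (fun b hb => h.2.2 l hl.1 b hb) hR
  have := Finset.card_le_card hLB
  rw [union_inter_card hdis, union_inter_card hdis, union_inter_card hdis, hRX,
    Finset.card_empty]
  omega

theorem big_component (hvt : VertexTransitive G)
    (hreg : G.IsRegularOfDegree 6) (htri : G.CliqueFree 3) (h5 : lambdaS G 5 = 16)
    (hcopy : ∃ L R, IsCopy G L R)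
    (X C : Finset V) (hXC : Disjoint X C)
    (hI : ∀ a ∈ (X ∪ C)ᶜ, ∀ b, b ∉ X → ¬ G.Adj a b)
    (hX4 : 4 ≤ X.card) (hcard : X.card = (X ∪ C)ᶜ.card + 3) (hC : 7 ≤ C.card)
    (hsum : ecnt G X X + ecnt G C Cᶜ = 18) : False := by
  have hXCc : X ⊆ Cᶜ := by
    intro x hx
    rw [Finset.mem_compl]
    exact Finset.disjoint_left.1 hXC hx
  have hCc4 : 4 ≤ Cᶜ.card := hX4.trans (Finset.card_le_card hXCc)
  have hdC := cut_ge G hreg htri h5 C (by omega) hCc4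
  have hEX : ecnt G X X ≤ 2 := by omega
  -- `Cᶜ` is large
  have hCc6 : 6 ≤ Cᶜ.card := by
    obtain ⟨i, hi⟩ := Finset.card_pos.1 (show 0 < (X ∪ C)ᶜ.card by omega)
    have h1 := ecnt_compl G hreg {i} X
    have h2 := ecnt_eq_zero G (A := {i}) (B := Xᶜ) (by
      intro a ha b hb
      rw [Finset.mem_singleton] at ha
      subst ha
      exact hI a hi b (by simpa using hb))
    have h3 := ecnt_singleton_le G i X
    have h4 := Finset.card_le_card hXCc
    rw [Finset.card_singleton] at h1
    omega
  have hdC' : ecnt G Cᶜ Cᶜᶜ = ecnt G C Cᶜ := by rw [compl_compl, ecnt_comm]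
  set B1 := C.filter (fun v => 4 ≤ ecnt G {v} Cᶜ) with hB1
  set B2 := Cᶜ.filter (fun v => 4 ≤ ecnt G {v} Cᶜᶜ) with hB2
  have b1 : B1.card ≤ 1 := bad_le_one G hreg htri h5 C (by omega) hCc4 (by omega)
  have b2 : B2.card ≤ 1 := bad_le_one G hreg htri h5 Cᶜ hCc6 (by rw [compl_compl]; omega) (by omega)
  have hm1 : ∀ v ∈ C, 4 ≤ ecnt G {v} Cᶜ → v ∈ B1 ∪ B2 := fun v hv h =>
    Finset.mem_union_left _ (Finset.mem_filter.2 ⟨hv, h⟩)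
  have hm2 : ∀ v ∈ X, 4 ≤ ecnt G {v} C → v ∈ B1 ∪ B2 := fun v hv h =>
    Finset.mem_union_right _ (Finset.mem_filter.2 ⟨hXCc hv, by rw [compl_compl]; exact h⟩)
  have main := copy_count G hvt hcopy X (X ∪ C)ᶜ (B1 ∪ B2) (by
    intro L R h
    rcases Finset.eq_empty_or_nonempty (L ∩ (X ∪ C)ᶜ) with hL | hL
    swap
    · exact copy_caseI G X C _ hEX hI hXC hm1 h hL
    rcases Finset.eq_empty_or_nonempty (R ∩ (X ∪ C)ᶜ) with hR | hR
    swap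
    · have := copy_caseI G X C _ hEX hI hXC hm1 h.symm hR
      rwa [Finset.union_comm R L] at this
    have sub : ∀ T : Finset V, T ∩ (X ∪ C)ᶜ = ∅ → ∀ t ∈ T, t ∉ X → t ∈ C := by
      intro T hT t ht htX
      by_contra htC
      have : t ∈ T ∩ (X ∪ C)ᶜ := by simp [ht, htX, htC]
      rw [hT] at this
      simp at this
    have sub2 : ∀ T : Finset V, T ∩ (X ∪ C)ᶜ = ∅ → T ∩ X = ∅ → T ⊆ C := by
      intro T hT hTX t ht
      refine sub T hT t ht fun htX => ?_
      have : t ∈ T ∩ X := Finset.mem_inter.2 ⟨ht, htX⟩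
      rw [hTX] at this
      simp at this
    rcases Finset.eq_empty_or_nonempty (R ∩ X) with hRX | hRX
    · exact copy_caseX G X C _ hm2 h (sub2 R hR hRX) hRX
    rcases Finset.eq_empty_or_nonempty (L ∩ X) with hLX | hLX
    · have := copy_caseX G X C _ hm2 h.symm (sub2 L hL hLX) hLX
      rwa [Finset.union_comm R L] at this
    exfalso
    have hdis := h.disj
    have hdd := double_le G (A := L ∩ X) (B := R ∩ X) (D := X) Finset.inter_subset_right
      Finset.inter_subset_right (hdis.mono Finset.inter_subset_left Finset.inter_subset_left)
      (fun a ha b hb => h.2.2 a (Finset.mem_inter.1 ha).1 b (Finset.mem_inter.1 hb).1)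
    have p1 := hRX.card_pos
    have p2 := hLX.card_pos
    have p3 : (R ∩ X).card ≤ 1 := by nlinarith
    have p4 : (L ∩ X).card ≤ 1 := by nlinarith
    have p5 := Finset.card_inter_add_card_sdiff L X
    have p6 := Finset.card_inter_add_card_sdiff R X
    have p7 := h.1
    have p8 := h.2.1
    have p9 : 1 ≤ (L ∩ X).card * (R ∩ X).card := Nat.mul_pos p2 p1
    obtain ⟨l, hl⟩ := hLX
    obtain ⟨r, hr⟩ := hRX
    rw [Finset.mem_inter] at hl hr
    have q1 : (R \ X).card ≤ ecnt G {l} Cᶜᶜ := by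
      refine adj_card_le G (fun b hb => h.2.2 l hl.1 b (Finset.mem_sdiff.1 hb).1) ?_
      intro t ht
      rw [Finset.mem_sdiff] at ht
      rw [compl_compl]
      exact sub R hR t ht.1 ht.2
    have q2 : (L \ X).card ≤ ecnt G {r} Cᶜᶜ := by
      refine adj_card_le G (fun b hb => (h.2.2 b (Finset.mem_sdiff.1 hb).1 r hr.1).symm) ?_
      intro t ht
      rw [Finset.mem_sdiff] at ht
      rw [compl_compl]
      exact sub L hL t ht.1 ht.2
    exact bad_zero G hreg htri h5 Cᶜ hCc6 (by rw [compl_compl]; omega) (by omega)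
      (hXCc hl.2) (hXCc hr.2) (h.2.2 l hl.1 r hr.1) (by omega) (by omega))
  have := Finset.card_union_le B1 B2
  omega

theorem no_structure (hvt : VertexTransitive G) (hnb : ¬ G.Colorable 2)
    (hreg : G.IsRegularOfDegree 6) (htri : G.CliqueFree 3) (h5 : lambdaS G 5 = 16)
    (hcopy : ∃ L R, IsCopy G L R) (hV : 13 ≤ Fintype.card V)
    (X C : Finset V) (hXC : Disjoint X C)
    (hI : ∀ a ∈ (X ∪ C)ᶜ, ∀ b, b ∉ X → ¬ G.Adj a b) (hX4 : 4 ≤ X.card)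
    (hcard : X.card ≤ (X ∪ C)ᶜ.card + 2 ∨ (X.card ≤ (X ∪ C)ᶜ.card + 3 ∧ Odd C.card)) :
    False := by
  set I := (X ∪ C)ᶜ with hId
  have hXc : Xᶜ = I ∪ C := by
    ext x
    have := fun h : x ∈ X => Finset.disjoint_left.1 hXC h
    simp only [hId, Finset.mem_compl, Finset.mem_union]
    tauto
  have hCc : Cᶜ = I ∪ X := by
    ext x
    have := fun h : x ∈ X => Finset.disjoint_left.1 hXC h
    simp only [hId, Finset.mem_compl, Finset.mem_union]
    tauto
  have dIC : Disjoint I C := by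
    rw [Finset.disjoint_left]; intro x; simp only [hId, Finset.mem_compl, Finset.mem_union]; tauto
  have dIX : Disjoint I X := by
    rw [Finset.disjoint_left]; intro x; simp only [hId, Finset.mem_compl, Finset.mem_union]; tauto
  have zII : ecnt G I I = 0 := ecnt_eq_zero G fun a ha b hb =>
    hI a ha b (Finset.disjoint_left.1 dIX hb)
  have zIC : ecnt G I C = 0 := ecnt_eq_zero G fun a ha b hb =>
    hI a ha b (fun h => Finset.disjoint_left.1 hXC h hb)
  have zCI := ecnt_comm G I C
  have zXI := ecnt_comm G I X
  have zXC := ecnt_comm G C X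
  have e1 := ecnt_compl G hreg X X
  rw [hXc, ecnt_union_right G X dIC] at e1
  have e2 := ecnt_compl G hreg I X
  rw [hXc, ecnt_union_right G I dIC] at e2
  have e3 := ecnt_compl G hreg C C
  have e4 : ecnt G C Cᶜ = ecnt G C I + ecnt G C X := by
    rw [hCc, ecnt_union_right G C dIX]
  have em : mono G X = ecnt G X X + ecnt G C C := by
    unfold mono
    rw [hXc, ecnt_union_left G _ dIC, ecnt_union_right G _ dIC, ecnt_union_right G _ dIC]
    omega
  have m := mantel G htri C
  have hno : 12 < mono G X := by
    by_contra hle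
    exact no_coloring G hvt hnb hreg htri h5 hcopy hV X (by omega)
  have hCc4 : 4 ≤ Cᶜ.card := by
    rw [hCc]
    exact hX4.trans (Finset.card_le_card Finset.subset_union_right)
  have small : X.card ≤ I.card + 2 → False := by
    intro h
    by_cases hC4 : 4 ≤ C.card
    · have := cut_ge G hreg htri h5 C hC4 hCc4
      omega
    · have hC3 : C.card ≤ 3 := by omega
      interval_cases C.card <;> omega
  rcases hcard with h | ⟨h, hodd⟩
  · exact small h
  · by_cases h2 : X.card ≤ I.card + 2
    · exact small h2
    · by_cases h7 : 7 ≤ C.card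
      · exact big_component G hvt hreg htri h5 hcopy X C hXC hI hX4 (by rw [← hId]; omega) h7
          (by omega)
      · have h6 : C.card ≤ 6 := by omega
        obtain ⟨t, ht⟩ := hodd
        have ht2 : t ≤ 2 := by omega
        rw [ht] at m e3
        interval_cases t <;> omega

theorem tutte_stage {W : Type*} [Fintype W] (H : SimpleGraph W) (f : W ↪ V)
    (hadj : ∀ a b, H.Adj a b ↔ G.Adj (f a) (f b))
    (hvt : VertexTransitive G) (hnb : ¬ G.Colorable 2)
    (hreg : G.IsRegularOfDegree 6) (htri : G.CliqueFree 3) (h5 : lambdaS G 5 = 16)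
    (hcopy : ∃ L R, IsCopy G L R) (hV : 13 ≤ Fintype.card V)
    (X : Finset V) (hX : Xᶜ = Finset.univ.map f) (hX4 : 4 ≤ X.card)
    (hodd : X.card ≤ H.oddComponents.ncard + 2) : False := by
  classical
  let _ : Fintype H.ConnectedComponent := Fintype.ofFinite _
  set K : H.ConnectedComponent → Finset V := fun c =>
    (Finset.univ.filter (fun w => H.connectedComponentMk w = c)).map f with hK
  have memK : ∀ w c, f w ∈ K c ↔ H.connectedComponentMk w = c := by
    intro w c
    simp [hK]
  have memX : ∀ v, v ∉ X ↔ ∃ w, f w = v := by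
    intro v
    rw [← Finset.mem_compl, hX]
    simp
  have hKX : ∀ c, Disjoint X (K c) := by
    intro c
    rw [Finset.disjoint_right]
    intro v hv
    rw [hK, Finset.mem_map] at hv
    obtain ⟨w, -, rfl⟩ := hv
    exact (memX _).2 ⟨w, rfl⟩
  have cardK : ∀ c, (K c).card = c.supp.ncard := by
    intro c
    rw [hK, Finset.card_map, ← Set.ncard_coe_finset]
    congr 1
    ext w
    simp [SimpleGraph.ConnectedComponent.mem_supp_iff]
  have posK : ∀ c, 1 ≤ (K c).card := by
    intro c
    induction c using SimpleGraph.ConnectedComponent.ind with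
    | _ w => exact Finset.card_pos.2 ⟨f w, (memK _ _).2 rfl⟩
  have fib : ∀ g : V → ℕ, ∑ c, ∑ v ∈ K c, g v = ∑ v ∈ Xᶜ, g v := by
    intro g
    rw [hX, Finset.sum_map]
    simp only [hK, Finset.sum_map]
    exact Finset.sum_fiberwise _ _ _
  have sumcard : ∑ c, (K c).card = Xᶜ.card := by
    simpa using fib (fun _ => 1)
  have sume : ∑ c, ecnt G (K c) X = ecnt G Xᶜ X := by
    have := fib (fun v => ecnt G {v} X)
    simpa only [← ecnt_sum] using this
  have same : ∀ a b, a ∉ X → b ∉ X → G.Adj a b → ∀ c, (a ∈ K c ↔ b ∈ K c) := by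
    intro a b ha hb hab c
    obtain ⟨w, rfl⟩ := (memX a).1 ha
    obtain ⟨w', rfl⟩ := (memX b).1 hb
    rw [memK, memK, SimpleGraph.ConnectedComponent.sound ((hadj w w').2 hab).reachable]
  have ecut : ∀ c, ecnt G (K c) (K c)ᶜ = ecnt G (K c) X := by
    intro c
    have hsplit : (K c)ᶜ = X ∪ (Xᶜ \ K c) := by
      ext v
      have := fun h : v ∈ X => Finset.disjoint_left.1 (hKX c) h
      simp only [Finset.mem_compl, Finset.mem_union, Finset.mem_sdiff]
      tauto
    have hz : ecnt G (K c) (Xᶜ \ K c) = 0 := by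
      refine ecnt_eq_zero G fun a ha b hb hab => ?_
      rw [Finset.mem_sdiff, Finset.mem_compl] at hb
      exact hb.2 ((same a b (Finset.disjoint_right.1 (hKX c) ha) hb.1 hab c).1 ha)
    rw [hsplit, ecnt_union_right, hz, add_zero]
    rw [Finset.disjoint_left]
    intro v hv
    simp [hv]
  have lb : ∀ c, 6 * (if Odd (K c).card then 1 else 0) + 8 * (if 2 ≤ (K c).card then 1 else 0)
      ≤ ecnt G (K c) X := by
    intro c
    rw [← ecut]
    by_cases h4 : 4 ≤ (K c).card
    · have : X.card ≤ (K c)ᶜ.card := Finset.card_le_card (by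
        intro v hv
        rw [Finset.mem_compl]
        exact Finset.disjoint_left.1 (hKX c) hv)
      have := cut_ge G hreg htri h5 (K c) h4 (by omega)
      split_ifs <;> omega
    · have e1 := ecnt_compl G hreg (K c) (K c)
      have e2 := mantel G htri (K c)
      have e3 := posK c
      have e4 : (K c).card ≤ 3 := by omega
      generalize ecnt G (K c) (K c)ᶜ = x at *
      generalize ecnt G (K c) (K c) = y at *
      generalize (K c).card = n at *
      have hn2 : ¬ Odd 2 := by decide
      interval_cases n
      · simp; omega
      · simp [hn2]; omega
      · split_ifs <;> omega
  have oddsum : H.oddComponents.ncard = ∑ c, (if Odd (K c).card then 1 else 0) := by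
    rw [← Finset.card_filter, ← Set.ncard_coe_finset]
    congr 1
    ext c
    simp [cardK]
  set T := Finset.univ.filter (fun c => 2 ≤ (K c).card) with hT
  have Tsum : T.card = ∑ c, (if 2 ≤ (K c).card then 1 else 0) := Finset.card_filter _ _
  have total := Finset.sum_le_sum (s := Finset.univ) (fun c _ => lb c)
  rw [Finset.sum_add_distrib, ← Finset.mul_sum, ← Finset.mul_sum, ← Tsum, ← oddsum, sume] at total
  have hXX := ecnt_compl G hreg X X
  have hcomm := ecnt_comm G X Xᶜ
  have hT1 : T.card ≤ 1 := by omega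
  have adjT : ∀ a b, a ∉ X → b ∉ X → G.Adj a b → ∀ c, a ∈ K c → c ∈ T := by
    intro a b ha hb hab c hac
    have hbc := (same a b ha hb hab c).1 hac
    rw [hT, Finset.mem_filter]
    exact ⟨Finset.mem_univ _, Finset.one_lt_card.2 ⟨a, hac, b, hbc, hab.ne⟩⟩
  have oddle : ∀ c, (if Odd (K c).card then 1 else 0) ≤ (K c).card := by
    intro c
    have := posK c
    split_ifs <;> omega
  have hnonempty : Nonempty H.ConnectedComponent := by
    by_contra hno
    rw [not_nonempty_iff] at hno
    rw [Set.eq_empty_of_isEmpty H.oddComponents, Set.ncard_empty] at hodd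
    omega
  rcases Finset.card_le_one_iff_subset_singleton.1 hT1 with ⟨c0, hc0⟩
  · refine no_structure G hvt hnb hreg htri h5 hcopy hV X (K c0) (hKX c0) ?_ hX4 ?_
    · intro a ha b hb hab
      rw [Finset.mem_compl, Finset.mem_union, not_or] at ha
      obtain ⟨w, rfl⟩ := (memX a).1 ha.1
      have := hc0 (adjT _ b ha.1 hb hab _ ((memK w _).2 rfl))
      rw [Finset.mem_singleton] at this
      exact ha.2 ((memK w _).2 this)
    · have s1 := Finset.add_sum_erase Finset.univ (fun c => (K c).card) (Finset.mem_univ c0)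
      have s2 := Finset.add_sum_erase Finset.univ (fun c => if Odd (K c).card then 1 else 0)
        (Finset.mem_univ c0)
      have s3 := Finset.sum_le_sum (s := Finset.univ.erase c0) (fun c _ => oddle c)
      have s4 : (X ∪ K c0)ᶜ.card + (K c0).card = Xᶜ.card := by
        have t1 := Finset.card_add_card_compl (X ∪ K c0)
        have t2 := Finset.card_add_card_compl X
        have t3 := Finset.card_union_of_disjoint (hKX c0)
        omega
      by_cases ho : Odd (K c0).card
      · right
        refine ⟨?_, ho⟩
        rw [if_pos ho] at s2
        omega
      · left
        rw [if_neg ho] at s2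
        omega

end Helpers

/-- (Lemma 3.9) `G` connected vertex-transitive non-bipartite
triangle-free of degree 6 and even order, not 4-factor-critical, with
`λ₅(G) = 16`. Then every `λ₅`-atom `S` of `G` satisfies `|S| ≥ 9`. -/
theorem statement17 {V : Type*} [Fintype V] [DecidableEq V]
    (G : SimpleGraph V) [DecidableRel G.Adj]
    (hconn : G.Connected) (hvt : VertexTransitive G) (hnb : ¬ G.Colorable 2)
    (htri : G.CliqueFree 3) (hreg : G.IsRegularOfDegree 6)
    (heven : Even (Fintype.card V)) (hnfc : ¬ PFactorCritical G 4)
    (h5 : lambdaS G 5 = 16)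
    (S : Set V) (hS : IsLambdaAtom G 5 S) :
    9 ≤ S.ncard := by
  classical
  by_contra hlt
  push Not at hlt
  obtain ⟨⟨⟨-, hdc, hcomp⟩, hcard⟩, -⟩ := hS
  rw [h5] at hcard
  set A : Finset V := S.toFinset with hA
  have hAS : (A : Set V) = S := by simp [hA]
  rw [← hAS] at hdc hcomp hcard hlt
  rw [Set.ncard_coe_finset] at hlt
  have hd : ecnt G A Aᶜ = 16 := by rw [← boundary_ncard]; exact hcard
  have hmem : ∀ x, 5 ≤ (Finset.univ.filter (fun y => y ∈ A ↔ x ∈ A)).card := by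
    intro x
    refine (hcomp (SimpleGraph.connectedComponentMk _ x)).trans ?_
    rw [← Set.ncard_coe_finset]
    refine Set.ncard_le_ncard ?_ (Set.toFinite _)
    intro y hy
    rw [SimpleGraph.ConnectedComponent.mem_supp_iff, SimpleGraph.ConnectedComponent.eq] at hy
    have := reach_mem G (A : Set V) hy
    simpa using this
  have hne : ecnt G A Aᶜ ≠ 0 := by omega
  have hA0 : A.Nonempty := by
    rw [Finset.nonempty_iff_ne_empty]
    intro h
    rw [h] at hne
    exact hne (ecnt_eq_zero G (by simp))
  have hA1 : Aᶜ.Nonempty := by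
    rw [Finset.nonempty_iff_ne_empty]
    intro h
    rw [h] at hne
    exact hne (ecnt_eq_zero G (by simp))
  obtain ⟨x, hx⟩ := hA0
  obtain ⟨y, hy⟩ := hA1
  have c1 : 5 ≤ A.card := by
    refine (hmem x).trans (Finset.card_le_card ?_)
    intro z hz
    simp only [Finset.mem_filter, Finset.mem_univ, true_and] at hz
    exact hz.2 hx
  have c2 : 5 ≤ Aᶜ.card := by
    refine (hmem y).trans (Finset.card_le_card ?_)
    intro z hz
    simp only [Finset.mem_filter, Finset.mem_univ, true_and] at hz
    rw [Finset.mem_compl] at hy ⊢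
    exact fun h => hy (hz.1 h)
  have m1 := mantel G htri A
  have m2 := ecnt_compl G hreg A A
  have hA8 : A.card = 8 := by
    have : A.card ≤ 8 := by omega
    generalize A.card = n at *
    interval_cases n <;> omega
  have hcopy := exists_copy G htri A hA8 (by omega)
  have hVc := Finset.card_add_card_compl A
  have hV : 13 ≤ Fintype.card V := by omega
  unfold PFactorCritical at hnfc
  push Not at hnfc
  obtain ⟨X0, hX0, hM⟩ := hnfc
  have hT : ¬ ∀ u, ¬ (G.induce X0ᶜ).IsTutteViolator u := by
    rw [← SimpleGraph.tutte]
    rintro ⟨M, hM'⟩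
    exact hM M hM'
  push Not at hT
  obtain ⟨u, hu⟩ := hT
  unfold SimpleGraph.IsTutteViolator at hu
  set P := (⊤ : (G.induce X0ᶜ).Subgraph).deleteVerts u with hP
  have hverts : P.verts = uᶜ := by
    ext w
    simp [hP]
  let f : P.verts ↪ V := ⟨fun w => w.1.1, fun a b h => Subtype.ext (Subtype.ext h)⟩
  have hadj : ∀ a b, P.coe.Adj a b ↔ G.Adj (f a) (f b) := by
    intro a b
    have ha : a.1 ∈ uᶜ := hverts.subset a.2
    have hb : b.1 ∈ uᶜ := hverts.subset b.2
    simp only [SimpleGraph.Subgraph.coe_adj, hP, SimpleGraph.Subgraph.deleteVerts_adj]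
    simp only [Set.mem_compl_iff] at ha hb
    simp only [ha, hb, SimpleGraph.Subgraph.verts_top, Set.mem_univ, not_false_eq_true,
      true_and, SimpleGraph.Subgraph.top_adj, SimpleGraph.comap_adj]
    exact Iff.rfl
  let _ : Fintype P.verts := Fintype.ofFinite _
  have hcW : Fintype.card P.verts + u.ncard + 4 = Fintype.card V := by
    have t1 := Set.ncard_add_ncard_compl u
    have t2 := Set.ncard_add_ncard_compl X0
    rw [← Nat.card_eq_fintype_card, ← Nat.card_eq_fintype_card, Nat.card_coe_set_eq, hverts]
    rw [Nat.card_coe_set_eq] at t1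
    omega
  have hcX : ((Finset.univ.map f)ᶜ).card = u.ncard + 4 := by
    rw [Finset.card_compl, Finset.card_map, Finset.card_univ]
    omega
  have hpar := P.coe.odd_ncard_oddComponents
  rw [Nat.card_eq_fintype_card] at hpar
  refine tutte_stage G P.coe f hadj hvt hnb hreg htri h5 hcopy hV (Finset.univ.map f)ᶜ
    (compl_compl _) (by omega) ?_
  rw [hcX]
  by_contra hlt2
  have heq : P.coe.oddComponents.ncard = u.ncard + 1 := by omega
  rw [heq] at hpar
  rw [Nat.odd_iff, Nat.odd_iff] at hpar
  rw [Nat.even_iff] at heven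
  omega
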